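/- Fix integers m ≥ 3 and q ≥ 1, and let w = (w₁,…,w_m) ∈ {2,3,…,q+1}^m. Then the integer D_w := K_m(w₁,…,w_m)·K_{m−1}(w₁,…,w_{m−1}) divides τ(G_w), the number of spanning trees of the simple graph G_w. -/

import Mathlib

/-- The number of spanning trees of a simple graph `G`: the number of
spanning subgraphs of `G` that are trees. -/
noncomputable def tau {V : Type} (G : SimpleGraph V) : ℕ :=
  Nat.card {H : SimpleGraph V // H ≤ G ∧ H.IsTree}

/-- The continuant `K_i(x₁,…,x_i)`: `K₀ = 1`, `K₁ = x₁`, and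
`K_i = x_i · K_{i-1} − K_{i-2}` for `i ≥ 2`. -/
def contK (x : ℕ → ℤ) : ℕ → ℤ
  | 0 => 1
  | 1 => x 1
  | (n + 2) => x (n + 2) * contK x (n + 1) - contK x n

/-- Vertices of the graph `G_w`: a root `ρ`, anchor vertices `a₁,…,a_q`,
and four paths `u₁−⋯−u_m`, `v₁−⋯−v_m`, `u′₁−⋯−u′_{m−1}`, `v′₁−⋯−v′_{m−1}`. -/
inductive Vert (m q : ℕ) : Type
  | rho : Vert m q
  | anchor : Fin q → Vert m q
  | u : Fin m → Vert m q
  | v : Fin m → Vert m q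
  | u' : Fin (m - 1) → Vert m q
  | v' : Fin (m - 1) → Vert m q

/-- `pathDeg r pos = δ_pos^{(r)}`, the degree of vertex `pos` in the path on
`r` vertices (positions numbered `1,…,r`). -/
def pathDeg (r pos : ℕ) : ℕ :=
  (if 1 < pos then 1 else 0) + (if pos < r then 1 else 0)

/-- The defining edge relation of `G_w` (before symmetrization).
A vertex `Vert.u i` with `i : Fin m` represents `u_{i+1}` (position `i+1 ∈ {1,…,m}`),
and similarly for the other paths and anchors. -/
def edgeRel (m q : ℕ) (w : ℕ → ℕ) : Vert m q → Vert m q → Prop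
  | .rho, .anchor _ => True
  | .u i, .u j => (j : ℕ) = (i : ℕ) + 1
  | .v i, .v j => (j : ℕ) = (i : ℕ) + 1
  | .u' i, .u' j => (j : ℕ) = (i : ℕ) + 1
  | .v' i, .v' j => (j : ℕ) = (i : ℕ) + 1
  | .u i, .anchor t => (t : ℕ) < w ((i : ℕ) + 1) - pathDeg m ((i : ℕ) + 1)
  | .v i, .anchor t => (t : ℕ) < w ((i : ℕ) + 1) - pathDeg m ((i : ℕ) + 1)
  | .u' i, .anchor t => (t : ℕ) < w ((i : ℕ) + 1) - pathDeg (m - 1) ((i : ℕ) + 1)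
  | .v' i, .anchor t => (t : ℕ) < w ((i : ℕ) + 1) - pathDeg (m - 1) ((i : ℕ) + 1)
  | _, _ => False

/-- The simple graph `G_w`. -/
def Gw (m q : ℕ) (w : ℕ → ℕ) : SimpleGraph (Vert m q) :=
  SimpleGraph.fromRel (edgeRel m q w)

theorem tau_comap_equiv {V W : Type} (e : W ≃ V) (G : SimpleGraph V) :
    tau (G.comap e) = tau G := by
  refine Nat.card_congr ((e.simpleGraph).subtypeEquiv fun H => ?_)
  have hH : H = (e.simpleGraph H).comap e := by
    ext x y
    simp
  generalize e.simpleGraph H = K at hH ⊢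
  subst hH
  refine and_congr ⟨fun h x y hxy => ?_, fun h x y hxy => h hxy⟩
    (SimpleGraph.Iso.comap e K).isTree_iff
  have := @h (e.symm x) (e.symm y)
  simp only [SimpleGraph.comap_adj, Equiv.apply_symm_apply] at this
  exact this hxy

section MatrixTree

variable {ι : Type}

/-- A parent function `f : ι → Option ι` is rooted if following parents always leads to the
root `none`, as witnessed by a strictly decreasing height. -/
def IsRooted (f : ι → Option ι) : Prop :=
  ∃ d : Option ι → ℕ, ∀ i, d (f i) < d (some i)

theorem isRooted_of_iterate_eq_none {f : ι → Option ι}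
    (h : ∀ x : Option ι, ∃ n, (fun y : Option ι => y.bind f)^[n] x = none) : IsRooted f := by
  classical
  refine ⟨fun x => Nat.find (h x), fun i => ?_⟩
  have hs := Nat.find_spec (h (some i))
  rcases hn : Nat.find (h (some i)) with _ | n
  · simp [hn] at hs
  · rw [hn, Function.iterate_succ_apply] at hs
    have h1 := Nat.find_min' (h (f i)) hs
    change Nat.find (h (f i)) < Nat.find (h (some i))
    omega

/-- The matrix `1 - A_f`, where `A_f` is the adjacency matrix of a parent function `f` with the
root deleted. -/
def parentMatrix [DecidableEq ι] (f : ι → Option ι) : Matrix ι ι ℤ :=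
  Matrix.of fun i j => (if i = j then 1 else 0) - (if f i = some j then 1 else 0)

theorem det_parentMatrix_of_isRooted [Fintype ι] [DecidableEq ι] {f : ι → Option ι}
    (hf : IsRooted f) : (parentMatrix f).det = 1 := by
  obtain ⟨d, hd⟩ := hf
  have hne : ∀ i j, d (some i) ≤ d (some j) → f i ≠ some j := by
    intro i j hij h
    have := hd i
    rw [h] at this
    omega
  have htri : (parentMatrix f).transpose.BlockTriangular (fun i => d (some i)) := by
    intro i j hij
    have h1 : j ≠ i := by rintro rfl; exact lt_irrefl _ hij
    simp [parentMatrix, h1, hne j i hij.le]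
  rw [← Matrix.det_transpose, htri.det]
  refine Finset.prod_eq_one fun a _ => ?_
  have hone : (parentMatrix f).transpose.toSquareBlock (fun i => d (some i)) a = 1 := ?_
  · rw [hone, Matrix.det_one]
  ext ⟨i, hi⟩ ⟨j, hj⟩
  simp [parentMatrix, Matrix.toSquareBlock, Matrix.toSquareBlockProp, Matrix.one_apply,
    hne j i (by rw [hi, hj]), eq_comm]

theorem det_parentMatrix_of_not_isRooted [Fintype ι] [DecidableEq ι] {f : ι → Option ι}
    (hf : ¬ IsRooted f) : (parentMatrix f).det = 0 := by
  classical
  set S : Option ι → Prop := fun x => ∀ n, (fun y : Option ι => y.bind f)^[n] x ≠ none with hS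
  have hnone : ¬ S none := fun h => h 0 rfl
  have hstep : ∀ i, S (some i) ↔ S (f i) := by
    refine fun i => ⟨fun h n => h (n + 1), fun h n => ?_⟩
    rcases n with _ | n
    · simp
    · exact h n
  obtain ⟨i₀, hi₀⟩ : ∃ i, S (some i) := by
    by_contra! hcon
    refine hf (isRooted_of_iterate_eq_none fun x => ?_)
    have : ¬ S x := by
      rcases x with _ | i
      exacts [hnone, hcon i]
    simpa [hS] using this
  rw [← Matrix.exists_mulVec_eq_zero_iff]
  refine ⟨fun i => if S (some i) then 1 else 0, fun h => ?_, ?_⟩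
  · simpa [hi₀] using congrFun h i₀
  · ext i
    simp only [Matrix.mulVec, dotProduct, parentMatrix, Matrix.of_apply, sub_mul,
      Finset.sum_sub_distrib, ite_mul, one_mul, zero_mul, Finset.sum_ite_eq, Finset.mem_univ,
      if_true, Pi.zero_apply]
    rcases hfi : f i with _ | j
    · have : ¬ S (some i) := by rw [hstep, hfi]; exact hnone
      simp [this]
    · have : S (some i) ↔ S (some j) := by rw [hstep, hfi]
      simp [this]

/-- The graph formed by the edges joining every `i` to its parent `f i`. -/
def parentGraph (f : ι → Option ι) : SimpleGraph (Option ι) :=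
  SimpleGraph.fromRel fun x y => ∃ i, x = some i ∧ y = f i

theorem IsRooted.ne {f : ι → Option ι} (hf : IsRooted f) (i : ι) : f i ≠ some i := by
  obtain ⟨d, hd⟩ := hf
  intro h
  have := hd i
  rw [h] at this
  exact lt_irrefl _ this

theorem IsRooted.parentGraph_adj {f : ι → Option ι} (hf : IsRooted f) (i : ι) :
    (parentGraph f).Adj (some i) (f i) :=
  (SimpleGraph.fromRel_adj _ _ _).2 ⟨(hf.ne i).symm, Or.inl ⟨i, rfl, rfl⟩⟩

theorem parentGraph_le {f : ι → Option ι} {G : SimpleGraph (Option ι)}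
    (h : ∀ i, G.Adj (some i) (f i)) : parentGraph f ≤ G := by
  intro x y hxy
  obtain ⟨-, ⟨i, rfl, rfl⟩ | ⟨i, rfl, rfl⟩⟩ := (SimpleGraph.fromRel_adj _ _ _).1 hxy
  exacts [h i, (h i).symm]

theorem IsRooted.connected_parentGraph {f : ι → Option ι} (hf : IsRooted f) :
    (parentGraph f).Connected := by
  obtain ⟨d, hd⟩ := id hf
  have key : ∀ n x, d x = n → (parentGraph f).Reachable x none := by
    intro n
    induction n using Nat.strong_induction_on with
    | _ n ih =>
      rintro (_ | i) hx
      · rfl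
      · exact (hf.parentGraph_adj i).reachable.trans (ih _ (hx ▸ hd i) _ rfl)
  exact ⟨fun x y => (key _ x rfl).trans (key _ y rfl).symm⟩

theorem IsRooted.isTree_parentGraph [Finite ι] {f : ι → Option ι} (hf : IsRooted f) :
    (parentGraph f).IsTree := by
  have hconn := hf.connected_parentGraph
  refine SimpleGraph.isTree_iff_connected_and_card.2
    ⟨hconn, le_antisymm ?_ hconn.card_vert_le_card_edgeSet_add_one⟩
  rw [Finite.card_option]
  refine Nat.succ_le_succ (Nat.card_le_card_of_surjective
    (fun i => (⟨s(some i, f i), hf.parentGraph_adj i⟩ : (parentGraph f).edgeSet)) ?_)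
  rintro ⟨e, he⟩
  induction e with
  | _ x y =>
    obtain ⟨-, ⟨i, rfl, rfl⟩ | ⟨i, rfl, rfl⟩⟩ := (SimpleGraph.fromRel_adj _ _ _).1
      ((SimpleGraph.mem_edgeSet _).1 he)
    exacts [⟨i, rfl⟩, ⟨i, Subtype.ext Sym2.eq_swap⟩]

theorem IsRooted.eq_of_parentGraph_eq {f g : ι → Option ι} (hf : IsRooted f)
    (h : parentGraph f = parentGraph g) : f = g := by
  obtain ⟨d, hd⟩ := id hf
  have key : ∀ n i, d (some i) = n → f i = g i := by
    intro n
    induction n using Nat.strong_induction_on with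
    | _ n ih =>
      intro i hi
      have hadj := hf.parentGraph_adj i
      rw [h] at hadj
      obtain ⟨-, ⟨j, hj, hfj⟩ | ⟨j, hj, hfj⟩⟩ := (SimpleGraph.fromRel_adj _ _ _).1 hadj
      · cases hj
        exact hfj
      · have h1 := hd i
        have h2 := hd j
        rw [ih (d (some j)) (by rw [← hj, ← hi]; exact h1) j rfl, ← hfj, ← hj] at h2
        omega
  exact funext fun i => key _ i rfl

theorem SimpleGraph.IsTree.exists_isRooted {H : SimpleGraph (Option ι)} (hH : H.IsTree) :
    ∃ f : ι → Option ι, IsRooted f ∧ parentGraph f = H := by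
  have hex : ∀ i, ∃ y, H.Adj (some i) y ∧ H.dist y none < H.dist (some i) none := by
    intro i
    obtain ⟨p, hp⟩ := hH.connected.exists_walk_length_eq_dist (some i) none
    cases p with
    | cons hadj p =>
      refine ⟨_, hadj, lt_of_le_of_lt (H.dist_le p) ?_⟩
      rw [← hp, SimpleGraph.Walk.length_cons]
      exact Nat.lt_succ_self _
  choose f hadj hlt using hex
  have hf : IsRooted f := ⟨fun x => H.dist x none, hlt⟩
  have hle := parentGraph_le hadj
  exact ⟨f, hf, le_antisymm hle
    ((SimpleGraph.isTree_iff_minimal_connected.1 hH).2 hf.connected_parentGraph hle)⟩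

theorem tau_eq_card_isRooted [Finite ι] (G : SimpleGraph (Option ι)) :
    tau G = Nat.card {f : ι → Option ι // (∀ i, G.Adj (some i) (f i)) ∧ IsRooted f} := by
  symm
  refine Nat.card_congr (Equiv.ofBijective
    (fun f => ⟨parentGraph f.1, parentGraph_le f.2.1, f.2.2.isTree_parentGraph⟩) ⟨?_, ?_⟩)
  · intro f g h
    exact Subtype.ext (f.2.2.eq_of_parentGraph_eq (congrArg Subtype.val h))
  · rintro ⟨H, hle, hH⟩
    obtain ⟨f, hf, rfl⟩ := hH.exists_isRooted
    exact ⟨⟨f, fun i => hle (hf.parentGraph_adj i), hf⟩, rfl⟩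

/-- The Laplacian of `G` with the row and column of the root `none` removed. -/
def reducedLap [Fintype ι] [DecidableEq ι] (G : SimpleGraph (Option ι)) [DecidableRel G.Adj] :
    Matrix ι ι ℤ :=
  Matrix.of fun i j => (if i = j then (G.degree (some i) : ℤ) else 0) -
    (if G.Adj (some i) (some j) then 1 else 0)

/-- **Kirchhoff's matrix tree theorem**. -/
theorem tau_eq_det_reducedLap [Fintype ι] [DecidableEq ι] (G : SimpleGraph (Option ι))
    [DecidableRel G.Adj] : (tau G : ℤ) = (reducedLap G).det := by
  classical
  have hrow : reducedLap G = fun i => ∑ y ∈ G.neighborFinset (some i),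
      fun j => ((if i = j then 1 else 0) - (if y = some j then 1 else 0) : ℤ) := by
    ext i j
    rw [Finset.sum_apply, Finset.sum_sub_distrib]
    simp [reducedLap]
  have hexp := (Matrix.detRowAlternating (R := ℤ) (n := ι)).toMultilinearMap.map_sum_finset
    (fun i (y : Option ι) j => ((if i = j then 1 else 0) - (if y = some j then 1 else 0) : ℤ))
    (fun i => G.neighborFinset (some i))
  have hdet : (reducedLap G).det =
      ∑ f ∈ Fintype.piFinset fun i => G.neighborFinset (some i), (parentMatrix f).det := by
    rw [hrow]
    exact hexp
  have hterm : ∀ f : ι → Option ι, (parentMatrix f).det = if IsRooted f then 1 else 0 := by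
    intro f
    split_ifs with hf
    exacts [det_parentMatrix_of_isRooted hf, det_parentMatrix_of_not_isRooted hf]
  rw [hdet, tau_eq_card_isRooted, Finset.sum_congr rfl fun f _ => hterm f, Finset.sum_boole,
    Nat.card_eq_fintype_card, Fintype.card_subtype]
  congr 2
  ext f
  simp

end MatrixTree

/-- The `r × r` tridiagonal matrix with diagonal `x₁, …, x_r` and off-diagonal entries `-1`. -/
def tridiag (x : ℕ → ℤ) (r : ℕ) : Matrix (Fin r) (Fin r) ℤ :=
  Matrix.of fun i j => if i = j then x (i + 1) else
    if (j : ℕ) = i + 1 ∨ (i : ℕ) = j + 1 then -1 else 0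

theorem det_tridiag (x : ℕ → ℤ) : ∀ r, (tridiag x r).det = contK x r
  | 0 => by simp [contK]
  | 1 => by simp [contK, tridiag]
  | n + 2 => by
    have h1 : (tridiag x (n + 2)).submatrix (Fin.last (n + 1)).succAbove
        (Fin.last (n + 1)).succAbove = tridiag x (n + 1) := by
      ext i j
      simp [tridiag]
    have h2 : ((tridiag x (n + 2)).submatrix (Fin.last (n + 1)).succAbove
        (Fin.last n).castSucc.succAbove).det = - contK x n := by
      rw [Matrix.det_succ_column _ (Fin.last n), Fin.sum_univ_castSucc, Finset.sum_eq_zero]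
      · have : (((tridiag x (n + 2)).submatrix (Fin.last (n + 1)).succAbove
            (Fin.last n).castSucc.succAbove).submatrix (Fin.last n).succAbove
            (Fin.last n).succAbove) = tridiag x n := by
          ext i j
          have hj : (Fin.last n).castSucc.succAbove j.castSucc = j.castSucc.castSucc :=
            Fin.succAbove_of_castSucc_lt _ _ (by simp [Fin.lt_def])
          simp [tridiag, hj]
        rw [this, det_tridiag x n]
        simp [tridiag, ← two_mul]
      · intro i _
        have hi := i.2
        have : ((tridiag x (n + 2)).submatrix (Fin.last (n + 1)).succAbove
            (Fin.last n).castSucc.succAbove) i.castSucc (Fin.last n) = 0 := by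
          simp [tridiag, Fin.ext_iff]
          omega
        rw [this]
        simp
    rw [Matrix.det_succ_row _ (Fin.last (n + 1)), Fin.sum_univ_castSucc, Fin.sum_univ_castSucc,
      Finset.sum_eq_zero]
    · rw [h1, h2, det_tridiag x (n + 1), contK]
      have e1 : tridiag x (n + 2) (Fin.last (n + 1)) (Fin.last (n + 1)) = x (n + 2) := by
        simp [tridiag]
      have e2 : tridiag x (n + 2) (Fin.last (n + 1)) (Fin.last n).castSucc = -1 := by
        simp [tridiag, Fin.ext_iff]
      rw [e1, e2]
      have s1 : (-1 : ℤ) ^ (((Fin.last (n + 1) : Fin (n + 2)) : ℕ) +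
          ((Fin.last (n + 1) : Fin (n + 2)) : ℕ)) = 1 := by simp [← two_mul]
      have s2 : (-1 : ℤ) ^ (((Fin.last (n + 1) : Fin (n + 2)) : ℕ) +
          ((Fin.last n).castSucc : ℕ)) = -1 := by
        simp only [Fin.val_last, Fin.val_castSucc]
        exact Odd.neg_one_pow ⟨n, by ring⟩
      rw [s1, s2]
      ring
    · intro i _
      have hi := i.2
      have : tridiag x (n + 2) (Fin.last (n + 1)) i.castSucc.castSucc = 0 := by
        simp [tridiag, Fin.ext_iff]
        omega
      rw [this]
      simp

/-- If the rows of two twin blocks of variables differ by `(M, -M, 0)`, then `det M` divides the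
determinant. -/
theorem Matrix.det_dvd_det_of_twin_blocks {P Q R : Type*} [Fintype P] [DecidableEq P] [Fintype Q]
    [DecidableEq Q] [CommRing R] (M : Matrix P P R) (L : Matrix (P ⊕ (P ⊕ Q)) (P ⊕ (P ⊕ Q)) R)
    (h₁ : ∀ i j, L (.inl i) (.inl j) - L (.inr (.inl i)) (.inl j) = M i j)
    (h₂ : ∀ i j, L (.inl i) (.inr (.inl j)) - L (.inr (.inl i)) (.inr (.inl j)) = -M i j)
    (h₃ : ∀ i j, L (.inl i) (.inr (.inr j)) = L (.inr (.inl i)) (.inr (.inr j))) :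
    M.det ∣ L.det := by
  have hmul : (fromBlocks 1 (fromCols (-1) 0) 0 1 : Matrix (P ⊕ (P ⊕ Q)) (P ⊕ (P ⊕ Q)) R) * L =
      fromBlocks M 0 0 1 *
        fromBlocks 1 (fromCols (-1) 0) L.toBlocks₂₁ L.toBlocks₂₂ := by
    conv_lhs => rw [← fromBlocks_toBlocks L]
    rw [fromBlocks_multiply, fromBlocks_multiply]
    congr 1
    · ext i j
      simp [Matrix.mul_apply, Fintype.sum_sum_type, Matrix.one_apply, toBlocks₁₁, toBlocks₂₁,
        ← h₁, sub_eq_add_neg]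
    · ext i (j | j)
      · simpa [Matrix.mul_apply, Fintype.sum_sum_type, Matrix.one_apply, toBlocks₁₂, toBlocks₂₂,
          sub_eq_add_neg] using h₂ i j
      · simp [Matrix.mul_apply, Fintype.sum_sum_type, Matrix.one_apply, toBlocks₁₂, toBlocks₂₂,
          h₃]
    · simp
    · simp
  have hdet := congrArg Matrix.det hmul
  rw [det_mul, det_mul, det_fromBlocks_zero₂₁, det_fromBlocks_zero₁₂] at hdet
  simp only [det_one, one_mul, mul_one] at hdet
  exact ⟨_, hdet⟩

/-- The non-root vertices of `G_w`, arranged as two twin copies of the paths, and the anchors. -/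
def Vert.equivOption (m q : ℕ) :
    Option ((Fin m ⊕ Fin (m - 1)) ⊕ ((Fin m ⊕ Fin (m - 1)) ⊕ Fin q)) ≃ Vert m q where
  toFun
    | none => .rho
    | some (.inl (.inl i)) => .u i
    | some (.inl (.inr i)) => .u' i
    | some (.inr (.inl (.inl i))) => .v i
    | some (.inr (.inl (.inr i))) => .v' i
    | some (.inr (.inr t)) => .anchor t
  invFun
    | .rho => none
    | .u i => some (.inl (.inl i))
    | .u' i => some (.inl (.inr i))
    | .v i => some (.inr (.inl (.inl i)))
    | .v' i => some (.inr (.inl (.inr i)))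
    | .anchor t => some (.inr (.inr t))
  left_inv := by rintro (_ | (_ | _) | (_ | _) | _) <;> rfl
  right_inv := by rintro (_ | _) <;> rfl

theorem sum_path_adj (r : ℕ) (i : Fin r) :
    (∑ j : Fin r, if (j : ℕ) = i + 1 ∨ (i : ℕ) = j + 1 then 1 else 0) = pathDeg r (i + 1) := by
  have hi := i.2
  have h : ∀ j : Fin r, (if (j : ℕ) = i + 1 ∨ (i : ℕ) = j + 1 then 1 else 0) =
      (if (i : ℕ) = j + 1 then 1 else 0) + (if (j : ℕ) = i + 1 then 1 else 0) := by
    intro j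
    split_ifs <;> omega
  rw [Finset.sum_congr rfl fun j _ => h j, Finset.sum_add_distrib, pathDeg]
  congr 1
  · split_ifs with h1
    · rw [Finset.sum_eq_single (⟨i - 1, by omega⟩ : Fin r)]
      · rw [if_pos]
        simp only
        omega
      · intro j _ hj
        rw [if_neg]
        simp only [ne_eq, Fin.ext_iff] at hj
        omega
      · simp
    · exact Finset.sum_eq_zero fun j _ => if_neg (by omega)
  · split_ifs with h1
    · rw [Finset.sum_eq_single (⟨i + 1, h1⟩ : Fin r)]
      · simp
      · intro j _ hj
        rw [if_neg]
        simpa [Fin.ext_iff] using hj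
      · simp
    · exact Finset.sum_eq_zero fun j _ => if_neg (by omega)

theorem sum_fin_lt {q h : ℕ} (hh : h ≤ q) : (∑ t : Fin q, if (t : ℕ) < h then 1 else 0) = h := by
  rw [Fin.sum_univ_eq_sum_range (fun t => if t < h then 1 else 0), Finset.sum_boole]
  have : (Finset.range q).filter (· < h) = Finset.range h := by
    ext t
    simp
    omega
  simp [this]

theorem continuant_product_dvd_tau (m q : ℕ) (hm : 3 ≤ m) (hq : 1 ≤ q)
    (w : ℕ → ℕ) (hw : ∀ i, 1 ≤ i → i ≤ m → 2 ≤ w i ∧ w i ≤ q + 1) :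
    contK (fun i => (w i : ℤ)) m * contK (fun i => (w i : ℤ)) (m - 1) ∣
      (tau (Gw m q w) : ℤ) := by
  classical
  set G := (Gw m q w).comap (Vert.equivOption m q) with hG
  have hdeg : ∀ x, G.degree x = ∑ y, if G.Adj x y then 1 else 0 := by
    intro x
    rw [← SimpleGraph.card_neighborFinset_eq_degree, SimpleGraph.neighborFinset_eq_filter,
      Finset.card_filter]
  have hsum : ∀ r i, m - 1 ≤ r → r ≤ m → i < r →
      pathDeg r (i + 1) + (w (i + 1) - pathDeg r (i + 1)) = w (i + 1) ∧
        w (i + 1) - pathDeg r (i + 1) ≤ q := by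
    intro r i h1 h2 h3
    have := hw (i + 1) (by omega) (by omega)
    unfold pathDeg
    split_ifs <;> omega
  have hadj : ∀ {r : ℕ} (i j : Fin r), (¬ i = j ∧ ((j : ℕ) = i + 1 ∨ (i : ℕ) = j + 1)) ↔
      ((j : ℕ) = i + 1 ∨ (i : ℕ) = j + 1) := by
    intro r i j
    rw [Fin.ext_iff]
    omega
  have hdu : ∀ i : Fin m, G.degree (some (.inl (.inl i))) = w (i + 1) := by
    intro i
    obtain ⟨h1, h2⟩ := hsum m i (by omega) le_rfl i.2
    rw [hdeg]
    simp only [hG, SimpleGraph.comap_adj, Vert.equivOption, Equiv.coe_fn_mk, Gw,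
      SimpleGraph.fromRel_adj, edgeRel, Fintype.sum_option, Fintype.sum_sum_type, ne_eq,
      reduceCtorEq, not_false_eq_true, or_false, and_false, if_false,
      Finset.sum_const_zero, add_zero, zero_add, true_and, Vert.u.injEq, hadj, sum_path_adj,
      sum_fin_lt h2, h1]
  have hdu' : ∀ i : Fin (m - 1), G.degree (some (.inl (.inr i))) = w (i + 1) := by
    intro i
    obtain ⟨h1, h2⟩ := hsum (m - 1) i le_rfl (by omega) i.2
    rw [hdeg]
    simp only [hG, SimpleGraph.comap_adj, Vert.equivOption, Equiv.coe_fn_mk, Gw,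
      SimpleGraph.fromRel_adj, edgeRel, Fintype.sum_option, Fintype.sum_sum_type, ne_eq,
      reduceCtorEq, not_false_eq_true, or_false, and_false, if_false,
      Finset.sum_const_zero, add_zero, zero_add, true_and, Vert.u'.injEq, hadj, sum_path_adj,
      sum_fin_lt h2, h1]
  have hdv : ∀ i : Fin m, G.degree (some (.inr (.inl (.inl i)))) = w (i + 1) := by
    intro i
    obtain ⟨h1, h2⟩ := hsum m i (by omega) le_rfl i.2
    rw [hdeg]
    simp only [hG, SimpleGraph.comap_adj, Vert.equivOption, Equiv.coe_fn_mk, Gw,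
      SimpleGraph.fromRel_adj, edgeRel, Fintype.sum_option, Fintype.sum_sum_type, ne_eq,
      reduceCtorEq, not_false_eq_true, or_false, and_false, if_false,
      Finset.sum_const_zero, add_zero, zero_add, true_and, Vert.v.injEq, hadj, sum_path_adj,
      sum_fin_lt h2, h1]
  have hdv' : ∀ i : Fin (m - 1), G.degree (some (.inr (.inl (.inr i)))) = w (i + 1) := by
    intro i
    obtain ⟨h1, h2⟩ := hsum (m - 1) i le_rfl (by omega) i.2
    rw [hdeg]
    simp only [hG, SimpleGraph.comap_adj, Vert.equivOption, Equiv.coe_fn_mk, Gw,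
      SimpleGraph.fromRel_adj, edgeRel, Fintype.sum_option, Fintype.sum_sum_type, ne_eq,
      reduceCtorEq, not_false_eq_true, or_false, and_false, if_false,
      Finset.sum_const_zero, add_zero, zero_add, true_and, Vert.v'.injEq, hadj, sum_path_adj,
      sum_fin_lt h2, h1]
  have htri : ∀ {r : ℕ} (i j : Fin r), tridiag (fun i => (w i : ℤ)) r i j =
      (if i = j then (w (i + 1) : ℤ) else 0) -
        (if (j : ℕ) = i + 1 ∨ (i : ℕ) = j + 1 then 1 else 0) := by
    intro r i j
    by_cases h : i = j
    · subst h
      simp [tridiag]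
    · simp only [tridiag, Matrix.of_apply, if_neg h, zero_sub]
      split_ifs <;> simp
  rw [← tau_comap_equiv (Vert.equivOption m q), ← hG, tau_eq_det_reducedLap G,
    ← det_tridiag, ← det_tridiag, ← Matrix.det_fromBlocks_zero₂₁ _ 0]
  apply Matrix.det_dvd_det_of_twin_blocks
  · rintro (i | i) (j | j) <;>
      simp [reducedLap, hdu, hdu', htri, hG, Vert.equivOption, Gw, edgeRel, hadj]
  · rintro (i | i) (j | j) <;>
      simp [reducedLap, hdv, hdv', htri, hG, Vert.equivOption, Gw, edgeRel, hadj]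
  · rintro (i | i) j <;>
      simp [reducedLap, hG, Vert.equivOption, Gw, edgeRel]
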